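/- Let n ≥ 2, N = 2n, and h = 1/n. The periodic second-difference matrix T_h^P maps the range of the odd extension operator E_{o,h} into itself: for every u ∈ range(E_{o,h}), T_h^P u ∈ range(E_{o,h}). -/

import Mathlib

open Matrix Finset

noncomputable section

/-- The tridiagonal matrix `tridiag(-1, 2, -1)` of size `m × m` (0-based indexing). -/
def tridiag (m : ℕ) : Matrix (Fin m) (Fin m) ℝ :=
  Matrix.of fun i j =>
    if (i : ℕ) = (j : ℕ) then 2
    else if (i : ℕ) + 1 = (j : ℕ) ∨ (j : ℕ) + 1 = (i : ℕ) then -1 else 0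

/-- The odd extension operator `E_{o,h} : ℝ^{n-1} → ℝ^{2n}`, sending the basis vector
`e_i^{n-1}` (math index `i = 1,…,n-1`) to `e_i^{2n} - e_{2n-i}^{2n}`.
In 0-based indexing, column `i` has entry `1` in row `i` and `-1` in row `2n - i - 2`. -/
def oddExt (n : ℕ) : Matrix (Fin (2 * n)) (Fin (n - 1)) ℝ :=
  Matrix.of fun k i =>
    if (k : ℕ) = (i : ℕ) then 1
    else if (k : ℕ) + (i : ℕ) + 2 = 2 * n then -1 else 0

/-- The restriction operator `R_{o,h} = (1/2) E_{o,h}ᵀ`. -/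
def oddRestr (n : ℕ) : Matrix (Fin (n - 1)) (Fin (2 * n)) ℝ :=
  (2 : ℝ)⁻¹ • (oddExt n)ᵀ

/-- The Dirichlet matrix `T_h^D = (1/h²) · tridiag(-1, 2, -1)`, with `h = 1/n`
(so `1/h² = n²`). -/
def ThD (n : ℕ) : Matrix (Fin (n - 1)) (Fin (n - 1)) ℝ :=
  ((n : ℝ) ^ 2) • tridiag (n - 1)

/-- The periodic matrix `T_h^P = (1/h²) · (tridiag(-1,2,-1) - e₁ e_Nᵀ - e_N e₁ᵀ)`,
with `h = 1/n`, `N = 2n` (0-based: corners at `(0, 2n-1)` and `(2n-1, 0)`). -/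
def ThP (n : ℕ) : Matrix (Fin (2 * n)) (Fin (2 * n)) ℝ :=
  ((n : ℝ) ^ 2) •
    (tridiag (2 * n)
      - Matrix.of (fun (i j : Fin (2 * n)) => if (i : ℕ) = 0 ∧ (j : ℕ) = 2 * n - 1 then 1 else 0)
      - Matrix.of (fun (i j : Fin (2 * n)) => if (i : ℕ) = 2 * n - 1 ∧ (j : ℕ) = 0 then 1 else 0))

/-- The `d`-fold Kronecker power `X^{⊗d}`, where `ℝ^{a^d}` is identified with the
space of functions `(Fin d → Fin a) → ℝ`. -/
def kronPow {a b : ℕ} (d : ℕ) (X : Matrix (Fin a) (Fin b) ℝ) :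
    Matrix (Fin d → Fin a) (Fin d → Fin b) ℝ :=
  Matrix.of fun i j => ∏ t, X (i t) (j t)

/-- `Σ_{t=1}^d I^{⊗(t-1)} ⊗ T ⊗ I^{⊗(d-t)}` in the function-indexed representation. -/
def kronSumId {m : ℕ} (d : ℕ) (T : Matrix (Fin m) (Fin m) ℝ) :
    Matrix (Fin d → Fin m) (Fin d → Fin m) ℝ :=
  ∑ t : Fin d, Matrix.of fun i j =>
    T (i t) (j t) * ∏ s ∈ Finset.univ.erase t, (if i s = j s then (1 : ℝ) else 0)

/-- The `d`-dimensional discrete Dirichlet reaction-diffusion matrix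
`A_h^D = Σ_j I^{⊗(j-1)} ⊗ T_h^D ⊗ I^{⊗(d-j)} + c I^{⊗d}`. -/
def AD (n d : ℕ) (c : ℝ) : Matrix (Fin d → Fin (n - 1)) (Fin d → Fin (n - 1)) ℝ :=
  kronSumId d (ThD n) + c • 1

/-- The `d`-dimensional discrete periodic reaction-diffusion matrix
`A_h^P = Σ_j I^{⊗(j-1)} ⊗ T_h^P ⊗ I^{⊗(d-j)} + c I^{⊗d}`. -/
def AP (n d : ℕ) (c : ℝ) : Matrix (Fin d → Fin (2 * n)) (Fin d → Fin (2 * n)) ℝ :=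
  kronSumId d (ThP n) + c • 1

/-- A pair `(M^D, M^P)` is LFA-compatible with respect to an extension `E` and a
restriction `R` if `M^D = R M^P E` and `M^P` maps `range E` into itself. -/
def LFACompatible {α β : Type*} [Fintype α] [Fintype β]
    (E : Matrix α β ℝ) (R : Matrix β α ℝ)
    (MD : Matrix β β ℝ) (MP : Matrix α α ℝ) : Prop :=
  MD = R * MP * E ∧ ∀ v ∈ Set.range E.mulVec, MP *ᵥ v ∈ Set.range E.mulVec

/-- Right multiplication by `E_{o,h}` antisymmetrizes the columns of a matrix. -/
lemma mul_oddExt_apply {α : Type*} (n : ℕ) (A : Matrix α (Fin (2 * n)) ℝ) (a : α)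
    (j : Fin (n - 1)) :
    (A * oddExt n) a j = A a ⟨j, by omega⟩ - A a ⟨2 * n - 2 - j, by omega⟩ := by
  have h (l : Fin (2 * n)) : oddExt n l j =
      (if l = ⟨j, by omega⟩ then 1 else 0) - if l = ⟨2 * n - 2 - j, by omega⟩ then 1 else 0 := by
    simp only [oddExt, Matrix.of_apply, Fin.ext_iff]
    split_ifs <;> first | omega | norm_num
  simp [Matrix.mul_apply, h, mul_sub]

/-- Left multiplication by `E_{o,h}` extends the rows of a matrix oddly. -/
lemma oddExt_mul_apply {β : Type*} (n : ℕ) (B : Matrix (Fin (n - 1)) β ℝ) (k : Fin (2 * n))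
    (b : β) :
    (oddExt n * B) k b =
      (if h : (k : ℕ) < n - 1 then B ⟨k, h⟩ b else 0)
        - if h : n ≤ (k : ℕ) ∧ (k : ℕ) < 2 * n - 1 then B ⟨2 * n - 2 - k, by omega⟩ b else 0 := by
  rw [Matrix.mul_apply]
  rcases lt_or_ge (k : ℕ) (n - 1) with hk | hk
  · rw [Finset.sum_eq_single ⟨k, hk⟩]
    · simp [oddExt, hk, show ¬ n ≤ (k : ℕ) by omega]
    · intro i _ hi
      have hi' : (k : ℕ) ≠ i := fun h => hi (Fin.ext h.symm)
      simp [oddExt, hi', show ¬ (k : ℕ) + i + 2 = 2 * n by omega]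
    · simp
  · by_cases hk' : n ≤ (k : ℕ) ∧ (k : ℕ) < 2 * n - 1
    · rw [Finset.sum_eq_single ⟨2 * n - 2 - k, by omega⟩]
      · simp [oddExt, hk', show ¬ (k : ℕ) < n - 1 by omega,
          show ¬ (k : ℕ) = 2 * n - 2 - k by omega,
          show (k : ℕ) + (2 * n - 2 - k) + 2 = 2 * n by omega]
      · intro i _ hi
        have hi' : (i : ℕ) ≠ 2 * n - 2 - k := fun h => hi (Fin.ext h)
        simp [oddExt, show ¬ (k : ℕ) = i by omega, show ¬ (k : ℕ) + i + 2 = 2 * n by omega]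
      · simp
    · rw [dif_neg hk.not_gt, dif_neg hk', sub_zero]
      refine Finset.sum_eq_zero fun i _ => ?_
      simp [oddExt, show ¬ (k : ℕ) = i by omega, show ¬ (k : ℕ) + i + 2 = 2 * n by omega]

/-- The odd extension intertwines the periodic and the Dirichlet second differences. -/
lemma ThP_mul_oddExt (n : ℕ) : ThP n * oddExt n = oddExt n * ThD n := by
  ext k j
  have hk := k.isLt
  have hj := j.isLt
  rw [mul_oddExt_apply, oddExt_mul_apply]
  simp only [ThP, ThD, tridiag, Matrix.smul_apply, Matrix.sub_apply, Matrix.of_apply, smul_eq_mul]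
  rw [← mul_sub]
  have h0 : ∀ (p : Prop) [Decidable p] (x : p → ℝ),
      (if h : p then (n : ℝ) ^ 2 * x h else 0) = (n : ℝ) ^ 2 * if h : p then x h else 0 := by
    intro p _ x
    split_ifs <;> simp
  rw [h0, h0, ← mul_sub]
  congr 1
  grind (splits := 30)

/-- `T_h^P` maps `range E_{o,h}` into itself. -/
theorem ThP_maps_range_oddExt (n : ℕ) (hn : 2 ≤ n) :
    ∀ u ∈ Set.range (oddExt n).mulVec, ThP n *ᵥ u ∈ Set.range (oddExt n).mulVec := by
  rintro _ ⟨v, rfl⟩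
  exact ⟨ThD n *ᵥ v, by rw [Matrix.mulVec_mulVec, Matrix.mulVec_mulVec, ThP_mul_oddExt]⟩
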